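/- Let K : {(n,m) ∈ ℤ² : |n| ≠ |m|} → ℂ satisfy: (i) |K(n,m)| ≤ C/|n-m|, and (ii) |K(n,m) - K(n,ℓ)| + |K(m,n) - K(ℓ,n)| ≤ C|m-ℓ|/(|m|-|n|)² whenever ||m|-|n|| > 2|m-ℓ| and |n|/2 ≤ |m|,|ℓ| ≤ 3|n|/2. If T is a bounded linear operator on ℓ²(ℤ) with T(f)(n) = Σ_m K(n,m) f(m) for all finitely supported f and n with f(n) = f(-n) = 0, then T extends to a bounded operator on ℓ^p(ℤ) for every 1 < p < ∞. -/

import Mathlib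

open scoped ENNReal

noncomputable section

namespace DiscreteCZ

/-- The dyadic interval of length `2 ^ k` that contains `n`. -/
def dyadicCube (k : ℕ) (n : ℤ) : Finset ℤ :=
  Finset.Ico (2 ^ k * (n / 2 ^ k)) (2 ^ k * (n / 2 ^ k) + 2 ^ k)

theorem mem_dyadicCube {k : ℕ} {n m : ℤ} : m ∈ dyadicCube k n ↔ m / 2 ^ k = n / 2 ^ k := by
  have h2 : (0 : ℤ) < 2 ^ k := by positivity
  rw [dyadicCube, Finset.mem_Ico, mul_comm, ← Int.le_ediv_iff_mul_le h2,
    ← add_one_mul, ← Int.ediv_lt_iff_lt_mul h2, Int.lt_add_one_iff, le_antisymm_iff, and_comm]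

theorem self_mem_dyadicCube (k : ℕ) (n : ℤ) : n ∈ dyadicCube k n := mem_dyadicCube.2 rfl

theorem card_dyadicCube (k : ℕ) (n : ℤ) : ((dyadicCube k n).card : ℝ) = 2 ^ k := by
  have : ((dyadicCube k n).card : ℤ) = 2 ^ k := by simp [dyadicCube]
  exact_mod_cast this

theorem dyadicCube_eq_of_mem {k : ℕ} {n m : ℤ} (h : m ∈ dyadicCube k n) :
    dyadicCube k m = dyadicCube k n := by
  rw [dyadicCube, dyadicCube, mem_dyadicCube.1 h]

theorem mem_dyadicCube_mono {k l : ℕ} (hkl : k ≤ l) {n m : ℤ} (h : m ∈ dyadicCube k n) :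
    m ∈ dyadicCube l n := by
  obtain ⟨i, rfl⟩ := Nat.exists_eq_add_of_le hkl
  rw [mem_dyadicCube] at h ⊢
  have h2 : (0 : ℤ) ≤ 2 ^ k := by positivity
  rw [pow_add, ← Int.ediv_ediv_of_nonneg h2, ← Int.ediv_ediv_of_nonneg h2, h]

theorem abs_sub_le_of_mem_dyadicCube {k : ℕ} {n m : ℤ} (h : m ∈ dyadicCube k n) :
    |n - m| ≤ 2 ^ k := by
  have h1 := self_mem_dyadicCube k n
  rw [dyadicCube, Finset.mem_Ico] at h h1
  rw [abs_le]
  constructor <;> linarith [h.1, h.2, h1.1, h1.2]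

theorem dyadicCube_zero (n : ℤ) : dyadicCube 0 n = {n} := by
  ext m
  simp [mem_dyadicCube]

/-- `E` is the set where the dyadic maximal function of `φ` exceeds `t`, and `κ n` is the scale of
the maximal dyadic interval around `n ∈ E` on which the average of `φ` exceeds `t`. -/
structure IsStopping (φ : ℤ → ℝ) (t : ℝ) (E : Finset ℤ) (κ : ℤ → ℕ) : Prop where
  stable : ∀ n ∈ E, ∀ m ∈ dyadicCube (κ n) n, m ∈ E ∧ κ m = κ n
  le_of_notMem : ∀ n ∉ E, ∀ k, ∑ m ∈ dyadicCube k n, φ m ≤ 2 ^ k * t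
  lt_of_mem : ∀ n ∈ E, 2 ^ κ n * t < ∑ m ∈ dyadicCube (κ n) n, φ m
  le_of_mem : ∀ n ∈ E, ∑ m ∈ dyadicCube (κ n) n, φ m ≤ 2 ^ (κ n + 1) * t

theorem sum_le_sum_of_support {φ : ℤ → ℝ} (hφ : ∀ n, 0 ≤ φ n) {s : Finset ℤ}
    (hs : ∀ n ∉ s, φ n = 0) {E : Finset ℤ} : ∑ m ∈ E, φ m ≤ ∑ m ∈ s, φ m := by
  rw [← Finset.sum_filter_of_ne (p := (· ∈ s)) fun m _ hm => by_contra fun h => hm (hs m h)]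
  exact Finset.sum_le_sum_of_subset_of_nonneg (fun m hm => (Finset.mem_filter.1 hm).2)
    fun _ _ _ => hφ _

theorem exists_isStopping {φ : ℤ → ℝ} (hφ : ∀ n, 0 ≤ φ n) {s : Finset ℤ}
    (hs : ∀ n ∉ s, φ n = 0) {t : ℝ} (ht : 0 < t) :
    ∃ E κ, IsStopping φ t E κ := by
  classical
  have hle (k n) : ∑ m ∈ dyadicCube k n, φ m ≤ ∑ m ∈ s, φ m := sum_le_sum_of_support hφ hs
  obtain ⟨N, hN⟩ : ∃ N : ℕ, ∑ m ∈ s, φ m ≤ 2 ^ N * t := by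
    obtain ⟨N, hN⟩ := pow_unbounded_of_one_lt ((∑ m ∈ s, φ m) / t) (one_lt_two)
    exact ⟨N, ((div_lt_iff₀ ht).1 hN).le⟩
  have hbig {k n} (hk : N ≤ k) : ∑ m ∈ dyadicCube k n, φ m ≤ 2 ^ k * t :=
    (hle k n).trans (hN.trans (by gcongr; norm_num))
  let bad (n : ℤ) (k : ℕ) : Prop := 2 ^ k * t < ∑ m ∈ dyadicCube k n, φ m
  let κ (n : ℤ) : ℕ := Nat.findGreatest (bad n) N
  have hlt {n k} (h : bad n k) : k ≤ N := by
    by_contra! hk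
    exact (hbig hk.le).not_gt h
  have hfin : {n | ∃ k, bad n k}.Finite := by
    refine (s.finite_toSet.biUnion fun m _ => (dyadicCube N m).finite_toSet).subset ?_
    rintro n ⟨k, hk⟩
    have h0 : ∑ m ∈ dyadicCube k n, φ m ≠ 0 := by
      have : 0 < 2 ^ k * t := by positivity
      exact (this.trans hk).ne'
    obtain ⟨m, hm, hm0⟩ := Finset.exists_ne_zero_of_sum_ne_zero h0
    have hms : m ∈ s := by
      by_contra h
      exact hm0 (hs m h)
    simp only [Set.mem_iUnion]
    have := mem_dyadicCube_mono (hlt hk) hm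
    exact ⟨m, hms, by simpa [mem_dyadicCube] using (mem_dyadicCube.1 this).symm⟩
  have hκ {n} (h : ∃ k, bad n k) : bad n (κ n) := by
    obtain ⟨k, hk⟩ := h
    exact Nat.findGreatest_spec (hlt hk) hk
  have hκle {n k} (h : bad n k) : k ≤ κ n := Nat.le_findGreatest (hlt h) h
  refine ⟨hfin.toFinset, κ, ?_, ?_, ?_, ?_⟩
  · intro n hn m hm
    have hn' := hκ (by simpa using hn)
    have key {k} (hk : κ n ≤ k) : bad m k ↔ bad n k := by
      simp only [bad, dyadicCube_eq_of_mem (mem_dyadicCube_mono hk hm)]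
    have hmb : bad m (κ n) := (key le_rfl).2 hn'
    refine ⟨by simpa using ⟨_, hmb⟩, le_antisymm ?_ (hκle hmb)⟩
    exact hκle ((key (hκle hmb)).1 (hκ ⟨_, hmb⟩))
  · intro n hn k
    have : ¬ ∃ k, bad n k := by simpa using hn
    push Not at this
    exact not_lt.1 (this k)
  · intro n hn
    exact hκ (by simpa using hn)
  · intro n hn
    have : ¬ bad n (κ n + 1) := fun h => absurd (hκle h) (by simp)
    refine le_trans ?_ (not_lt.1 this)
    exact Finset.sum_le_sum_of_subset_of_nonneg
      (fun m hm => mem_dyadicCube_mono (Nat.le_succ _) hm) fun _ _ _ => hφ _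

namespace IsStopping

variable {φ : ℤ → ℝ} {t : ℝ} {E : Finset ℤ} {κ : ℤ → ℕ}

theorem sum_comm {M : Type*} [AddCommMonoid M] (h : IsStopping φ t E κ) (Φ : ℤ → ℤ → M) :
    ∑ n ∈ E, ∑ m ∈ dyadicCube (κ n) n, Φ n m = ∑ m ∈ E, ∑ n ∈ dyadicCube (κ m) m, Φ n m := by
  have key {n m : ℤ} (hn : n ∈ E) (hm : m ∈ dyadicCube (κ n) n) :
      n ∈ dyadicCube (κ m) m ∧ m ∈ E := by
    obtain ⟨h1, h2⟩ := h.stable n hn m hm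
    rw [h2]
    exact ⟨mem_dyadicCube.2 (mem_dyadicCube.1 hm).symm, h1⟩
  exact Finset.sum_comm' fun n m => ⟨fun ⟨hn, hm⟩ => key hn hm, fun ⟨hm, hn⟩ => (key hn hm).symm⟩

theorem le_of_notMem_self (h : IsStopping φ t E κ) {n : ℤ} (hn : n ∉ E) : φ n ≤ t := by
  simpa [dyadicCube_zero] using h.le_of_notMem n hn 0

theorem sum_average (h : IsStopping φ t E κ) (ψ : ℤ → ℝ) :
    ∑ n ∈ E, ∑ m ∈ dyadicCube (κ n) n, ((2 : ℝ) ^ κ n)⁻¹ * ψ m = ∑ m ∈ E, ψ m := by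
  rw [h.sum_comm]
  refine Finset.sum_congr rfl fun m hm => ?_
  have h1 : ∀ n ∈ dyadicCube (κ m) m, ((2 : ℝ) ^ κ n)⁻¹ * ψ m = ((2 : ℝ) ^ κ m)⁻¹ * ψ m :=
    fun n hn => by rw [(h.stable m hm n hn).2]
  rw [Finset.sum_congr rfl h1, Finset.sum_const, nsmul_eq_mul, card_dyadicCube,
    mul_inv_cancel_left₀ (by positivity)]

/-- Weak-type estimate for the dyadic maximal function, in truncated form. -/
theorem mul_card_le (h : IsStopping φ t E κ) (ht : 0 ≤ t) :
    t * E.card ≤ 2 * ∑ m ∈ E, if t / 2 < φ m then φ m else 0 := by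
  rw [← h.sum_average, Finset.mul_sum, mul_comm, ← nsmul_eq_mul]
  refine Finset.card_nsmul_le_sum _ _ _ fun n hn => ?_
  rw [← Finset.mul_sum]
  have h1 : ∑ m ∈ dyadicCube (κ n) n, φ m ≤
      ∑ m ∈ dyadicCube (κ n) n, ((if t / 2 < φ m then φ m else 0) + t / 2) := by
    refine Finset.sum_le_sum fun m _ => ?_
    split_ifs <;> linarith
  rw [Finset.sum_add_distrib, Finset.sum_const, nsmul_eq_mul, card_dyadicCube] at h1
  have h2 := h.lt_of_mem n hn
  have h3 : (0 : ℝ) < 2 ^ κ n := by positivity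
  rw [← mul_assoc, mul_comm 2, mul_assoc, ← div_eq_inv_mul, le_div_iff₀ h3]
  linarith

end IsStopping

/-- The good part of `f`: its averages over the stopping intervals, and `f` itself elsewhere. -/
def goodPart (E : Finset ℤ) (κ : ℤ → ℕ) (f : ℤ → ℂ) (n : ℤ) : ℂ :=
  if n ∈ E then ((2 : ℂ) ^ κ n)⁻¹ * ∑ m ∈ dyadicCube (κ n) n, f m else f n

namespace IsStopping

variable {f : ℤ → ℂ} {t : ℝ} {E : Finset ℤ} {κ : ℤ → ℕ}

theorem norm_goodPart_le (h : IsStopping (fun n => ‖f n‖) t E κ) {n : ℤ} (hn : n ∈ E) :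
    ‖goodPart E κ f n‖ ≤ 2 * t := by
  have h3 : (0 : ℝ) < 2 ^ κ n := by positivity
  rw [goodPart, if_pos hn, norm_mul, norm_inv, norm_pow, Complex.norm_ofNat, inv_mul_le_iff₀ h3,
    ← mul_assoc, ← pow_succ]
  exact (norm_sum_le _ _).trans (h.le_of_mem n hn)

/-- Cancellation in the bad part `f - goodPart E κ f`. -/
theorem norm_sum_bad_le (h : IsStopping (fun n => ‖f n‖) t E κ) (c : ℤ → ℂ) (δ : ℤ → ℝ)
    (hδ : ∀ m ∈ E, ∀ l ∈ dyadicCube (κ m) m, ‖c m - c l‖ ≤ δ m) :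
    ‖∑ m ∈ E, c m * (f m - goodPart E κ f m)‖ ≤ ∑ m ∈ E, ‖f m‖ * δ m := by
  have h1 : ∑ m ∈ E, c m * goodPart E κ f m =
      ∑ m ∈ E, f m * (((2 : ℂ) ^ κ m)⁻¹ * ∑ l ∈ dyadicCube (κ m) m, c l) := by
    calc _ = ∑ m ∈ E, ∑ l ∈ dyadicCube (κ m) m, c m * (((2 : ℂ) ^ κ m)⁻¹ * f l) :=
          Finset.sum_congr rfl fun m hm => by
            rw [goodPart, if_pos hm, Finset.mul_sum, Finset.mul_sum]
      _ = _ := by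
        rw [h.sum_comm]
        refine Finset.sum_congr rfl fun m hm => ?_
        rw [Finset.mul_sum, Finset.mul_sum]
        refine Finset.sum_congr rfl fun l hl => ?_
        rw [(h.stable m hm l hl).2]
        ring
  have h2 : ∑ m ∈ E, c m * (f m - goodPart E κ f m) =
      ∑ m ∈ E, f m * (((2 : ℂ) ^ κ m)⁻¹ * ∑ l ∈ dyadicCube (κ m) m, (c m - c l)) := by
    simp only [mul_sub, Finset.sum_sub_distrib, h1]
    congr 1
    refine Finset.sum_congr rfl fun m _ => ?_
    have h4 : ((dyadicCube (κ m) m).card : ℂ) = 2 ^ κ m := by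
      exact_mod_cast card_dyadicCube (κ m) m
    rw [Finset.sum_const, nsmul_eq_mul, h4, inv_mul_cancel_left₀ (pow_ne_zero _ two_ne_zero), mul_comm]
  rw [h2]
  refine (norm_sum_le _ _).trans (Finset.sum_le_sum fun m hm => ?_)
  have h3 : (0 : ℝ) < 2 ^ κ m := by positivity
  rw [norm_mul, norm_mul, norm_inv, norm_pow, Complex.norm_ofNat]
  gcongr
  rw [inv_mul_le_iff₀ h3, ← card_dyadicCube, ← nsmul_eq_mul]
  exact (norm_sum_le _ _).trans (Finset.sum_le_card_nsmul _ _ _ fun l hl => hδ m hm l hl)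

/-- The Hardy averages of `f` over `E` are controlled off `E ∪ -E`. -/
theorem hardy_le (h : IsStopping (fun n => ‖f n‖) t E κ) (ht : 0 ≤ t) {n : ℤ}
    (hn : n ∉ E) (hn' : -n ∉ E) :
    (∑ m ∈ E, if |m| ≤ |n| then ‖f m‖ else 0) / |(n : ℝ)| ≤ 4 * t := by
  classical
  rcases eq_or_ne n 0 with rfl | h0
  · simpa using ht
  have hpos : (0 : ℝ) < |(n : ℝ)| := by positivity
  set k := Nat.log 2 n.natAbs with hk
  have hk1 : 2 ^ k ≤ n.natAbs := Nat.pow_log_le_self 2 (by simpa using h0)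
  have hk2 : n.natAbs < 2 ^ (k + 1) := Nat.lt_pow_succ_log_self (by norm_num) _
  have hk1' : (2 : ℝ) ^ k ≤ |(n : ℝ)| := by
    rw [← Int.cast_abs, Int.abs_eq_natAbs]
    exact_mod_cast hk1
  have hk2' : |n| < 2 ^ (k + 1) := by
    rw [Int.abs_eq_natAbs]
    exact_mod_cast hk2
  rw [div_le_iff₀ hpos, ← Finset.sum_filter]
  have hsub : E.filter (fun m => |m| ≤ |n|) ⊆ dyadicCube (k + 1) n ∪ dyadicCube (k + 1) (-n) := by
    intro m hm
    have hm := (Finset.mem_filter.1 hm).2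
    have hpos {x : ℤ} (hx : |x| < 2 ^ (k + 1)) (hx0 : 0 ≤ x) : x / 2 ^ (k + 1) = 0 :=
      Int.ediv_eq_zero_of_lt hx0 (abs_lt.1 hx).2
    have hneg {x : ℤ} (hx : |x| < 2 ^ (k + 1)) (hx0 : x < 0) : x / 2 ^ (k + 1) = -1 := by
      have h2 : (0 : ℤ) < 2 ^ (k + 1) := by positivity
      refine le_antisymm ?_ ?_
      · have : x / 2 ^ (k + 1) < 0 := (Int.ediv_lt_iff_lt_mul h2).2 (by simpa using hx0)
        lia
      · exact (Int.le_ediv_iff_mul_le h2).2 (by linarith [(abs_lt.1 hx).1])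
    have hmlt := hm.trans_lt hk2'
    have hnlt : |-n| < 2 ^ (k + 1) := by rwa [abs_neg]
    rw [Finset.mem_union, mem_dyadicCube, mem_dyadicCube]
    rcases lt_or_ge m 0 with h1 | h1 <;> rcases lt_or_gt_of_ne h0 with h2 | h2
    · exact .inl ((hneg hmlt h1).trans (hneg hk2' h2).symm)
    · exact .inr ((hneg hmlt h1).trans (hneg hnlt (by lia)).symm)
    · exact .inr ((hpos hmlt h1).trans (hpos hnlt (by lia)).symm)
    · exact .inl ((hpos hmlt h1).trans (hpos hk2' h2.le).symm)
  calc _ ≤ ∑ m ∈ dyadicCube (k + 1) n ∪ dyadicCube (k + 1) (-n), ‖f m‖ :=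
        Finset.sum_le_sum_of_subset_of_nonneg hsub fun _ _ _ => norm_nonneg _
    _ ≤ ∑ m ∈ dyadicCube (k + 1) n, ‖f m‖ + ∑ m ∈ dyadicCube (k + 1) (-n), ‖f m‖ := by
        rw [← Finset.sum_union_inter]
        exact le_add_of_nonneg_right (Finset.sum_nonneg fun _ _ => norm_nonneg _)
    _ ≤ 2 ^ (k + 1) * t + 2 ^ (k + 1) * t :=
        add_le_add (h.le_of_notMem n hn _) (h.le_of_notMem (-n) hn' _)
    _ = 4 * t * 2 ^ k := by ring
    _ ≤ _ := by gcongr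

end IsStopping

theorem sum_inv_sq_tail_le (F : Finset ℤ) (c : ℤ) {H : ℕ} (hH : H ≠ 0) :
    ∑ n ∈ F, (if (H : ℤ) < |n - c| then (((n - c : ℤ) : ℝ) ^ 2)⁻¹ else 0) ≤ 2 * (H : ℝ)⁻¹ := by
  classical
  have key (G : Finset ℤ) (e : ℤ → ℕ) (he : Set.InjOn e G)
      (hG : ∀ n ∈ G, H < e n ∧ |n - c| = e n) :
      ∑ n ∈ G, (((n - c : ℤ) : ℝ) ^ 2)⁻¹ ≤ (H : ℝ)⁻¹ := by
    calc _ = ∑ n ∈ G, ((e n : ℝ) ^ 2)⁻¹ := Finset.sum_congr rfl fun n hn => by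
          rw [← sq_abs, ← Int.cast_abs, (hG n hn).2, Int.cast_natCast]
      _ = ∑ i ∈ G.image e, ((i : ℝ) ^ 2)⁻¹ :=
          (Finset.sum_image (f := fun i : ℕ => ((i : ℝ) ^ 2)⁻¹) he).symm
      _ ≤ ∑ i ∈ Finset.Ioc H (H + (G.image e).sup id), ((i : ℝ) ^ 2)⁻¹ := by
          refine Finset.sum_le_sum_of_subset_of_nonneg (fun i hi => ?_) fun _ _ _ => by positivity
          have h1 := Finset.le_sup (f := id) hi
          obtain ⟨n, hn, rfl⟩ := Finset.mem_image.1 hi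
          rw [Finset.mem_Ioc]
          exact ⟨(hG n hn).1, h1.trans (Nat.le_add_left _ _)⟩
      _ ≤ _ := (sum_Ioc_inv_sq_le_sub hH (Nat.le_add_right _ _)).trans
          (sub_le_self _ (by positivity))
  rw [← Finset.sum_filter, ← Finset.sum_filter_add_sum_filter_not _ (fun n => c ≤ n), two_mul]
  refine add_le_add (key _ (fun n => (n - c).toNat) ?_ ?_) (key _ (fun n => (c - n).toNat) ?_ ?_)
  · intro x hx y hy
    simp only [Finset.coe_filter, Finset.mem_filter, Set.mem_ofPred_eq] at hx hy ⊢
    lia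
  · intro n hn
    simp only [Finset.mem_filter] at hn
    rw [abs_of_nonneg (by lia)] at hn ⊢
    lia
  · intro x hx y hy
    simp only [Finset.coe_filter, Finset.mem_filter, Set.mem_ofPred_eq] at hx hy ⊢
    lia
  · intro n hn
    simp only [Finset.mem_filter] at hn
    rw [abs_of_nonpos (by lia)] at hn ⊢
    lia

theorem sum_inv_sq_abs_tail_le (F : Finset ℤ) (c : ℤ) {H : ℕ} (hH : H ≠ 0) :
    ∑ n ∈ F, (if (H : ℤ) < |(|n| - c)| then (((|n| - c : ℤ) : ℝ) ^ 2)⁻¹ else 0)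
      ≤ 4 * (H : ℝ)⁻¹ := by
  calc _ ≤ ∑ n ∈ F, ((if (H : ℤ) < |n - c| then (((n - c : ℤ) : ℝ) ^ 2)⁻¹ else 0) +
          (if (H : ℤ) < |n - -c| then (((n - -c : ℤ) : ℝ) ^ 2)⁻¹ else 0)) := by
        refine Finset.sum_le_sum fun n _ => ?_
        rcases abs_choice n with h | h <;> rw [h]
        · exact le_add_of_nonneg_right (by positivity)
        · refine le_add_of_nonneg_of_le (by positivity) (le_of_eq ?_)
          rw [show -n - c = -(n - -c) by ring, abs_neg, Int.cast_neg, neg_sq]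
    _ ≤ 2 * (H : ℝ)⁻¹ + 2 * (H : ℝ)⁻¹ := by
        rw [Finset.sum_add_distrib]
        exact add_le_add (sum_inv_sq_tail_le F c hH) (sum_inv_sq_tail_le F (-c) hH)
    _ = _ := by ring

theorem card_abs_sub_le (F : Finset ℤ) (c : ℤ) (R : ℕ) :
    (F.filter fun n => |(|n| - c)| ≤ R).card ≤ 4 * R + 2 := by
  classical
  have hsub : F.filter (fun n => |(|n| - c)| ≤ R) ⊆
      Finset.Icc (c - R) (c + R) ∪ Finset.Icc (-c - R) (-c + R) := by
    intro n hn
    have := (Finset.mem_filter.1 hn).2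
    simp only [Finset.mem_union, Finset.mem_Icc]
    grind
  refine (Finset.card_le_card hsub).trans ((Finset.card_union_le _ _).trans ?_)
  simp only [Int.card_Icc]
  lia

theorem card_abs_lt (F : Finset ℤ) (c : ℤ) :
    ((F.filter fun n => |n| < |c|).card : ℝ) ≤ 2 * |(c : ℝ)| := by
  have hsub : F.filter (fun n => |n| < |c|) ⊆ Finset.Ico (-|c|) |c| := by
    intro n hn
    have := abs_lt.1 (Finset.mem_filter.1 hn).2
    exact Finset.mem_Ico.2 ⟨this.1.le, this.2⟩
  have h1 := Finset.card_le_card hsub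
  rw [Int.card_Ico] at h1
  have h2 : ((F.filter fun n => |n| < |c|).card : ℤ) ≤ 2 * |c| := by
    have := abs_nonneg c
    lia
  rw [← Int.cast_abs]
  exact_mod_cast h2

/-- The size condition, and the smoothness condition in the second variable, for the entries of a
matrix indexed by `ℤ`, away from the two diagonals `|n| = |m|`. -/
structure IsCZKernel (a : ℤ → ℤ → ℂ) (C : ℝ) : Prop where
  size : ∀ n m : ℤ, |n| ≠ |m| → ‖a n m‖ ≤ C / ((|n - m| : ℤ) : ℝ)
  smooth : ∀ n m l : ℤ, |n| ≠ |m| → |n| ≠ |l| → 2 * |m - l| < |(|m| - |n|)| →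
    |n| ≤ 2 * |m| → 2 * |m| ≤ 3 * |n| → |n| ≤ 2 * |l| → 2 * |l| ≤ 3 * |n| →
    ‖a n m - a n l‖ ≤ C * ((|m - l| : ℤ) : ℝ) / (((|m| - |n| : ℤ) : ℝ)) ^ 2

/-- The matrix `a` acts boundedly on finitely supported sequences in the `ℓ^p` norm. -/
def IsLpBdd (a : ℤ → ℤ → ℂ) (p B : ℝ) : Prop :=
  ∀ (s F : Finset ℤ) (f : ℤ → ℂ),
    ∑ n ∈ F, ‖∑ m ∈ s, a n m * f m‖ ^ p ≤ B * ∑ m ∈ s, ‖f m‖ ^ p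

namespace IsCZKernel

variable {a : ℤ → ℤ → ℂ} {C : ℝ}

theorem norm_le_of_max_le (ha : IsCZKernel a C) (hC : 0 ≤ C) {n m M : ℤ} (hM : 0 < M)
    (h : M ≤ 8 * |(|n| - |m|)|) : ‖a n m‖ ≤ 8 * C * (M : ℝ)⁻¹ := by
  have hne : |n| ≠ |m| := by
    intro h0
    rw [h0] at h
    simp at h
    lia
  have h1 : M ≤ 8 * |n - m| := h.trans (by linarith [abs_abs_sub_abs_le n m])
  have h1' : (M : ℝ) ≤ 8 * ((|n - m| : ℤ) : ℝ) := by exact_mod_cast h1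
  have hM' : (0 : ℝ) < M := by exact_mod_cast hM
  refine (ha.size n m hne).trans ?_
  rw [← div_eq_mul_inv, div_le_div_iff₀ (by linarith) hM']
  calc C * M ≤ C * (8 * ((|n - m| : ℤ) : ℝ)) := by gcongr
    _ = _ := by ring

theorem norm_sub_le (ha : IsCZKernel a C) (hC : 0 ≤ C) {n m l : ℤ} {h : ℕ}
    (hml : |m - l| ≤ h) (hm : 4 * (h : ℤ) < |(|n| - |m|)|) (hl : 4 * (h : ℤ) < |(|n| - |l|)|) :
    ‖a n m - a n l‖ ≤
      C * h * (((|n| - |m| : ℤ) : ℝ) ^ 2)⁻¹ + 16 * C * ((max |n| |m| : ℤ) : ℝ)⁻¹ := by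
  have hne : |n| ≠ |m| := by
    intro h0
    simp [h0] at hm
    lia
  have hne' : |n| ≠ |l| := by
    intro h0
    simp [h0] at hl
    lia
  have hn0 := abs_nonneg n
  have hm0 := abs_nonneg m
  have hl0 := abs_nonneg l
  have hml' : |(|m| - |l|)| ≤ h := (abs_abs_sub_abs_le m l).trans hml
  have hMpos : 0 < max |n| |m| := by
    rw [lt_max_iff]
    lia
  have hMpos' : (0 : ℝ) < ((max |n| |m| : ℤ) : ℝ) := by exact_mod_cast hMpos
  by_cases hloc : |n| ≤ 2 * |m| ∧ 2 * |m| ≤ 3 * |n| ∧ |n| ≤ 2 * |l| ∧ 2 * |l| ≤ 3 * |n|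
  · obtain ⟨h1, h2, h3, h4⟩ := hloc
    have h5 : 2 * |m - l| < |(|m| - |n|)| := by
      rw [abs_sub_comm |m| |n|]
      have := abs_nonneg (m - l)
      lia
    refine (ha.smooth n m l hne hne' h5 h1 h2 h3 h4).trans ?_
    have hml'' : ((|m - l| : ℤ) : ℝ) ≤ h := by exact_mod_cast hml
    have h6 : (((|m| - |n| : ℤ) : ℝ)) ^ 2 = (((|n| - |m| : ℤ) : ℝ)) ^ 2 := by
      push_cast
      ring
    rw [h6, div_eq_mul_inv]
    refine le_add_of_le_of_nonneg ?_ (by positivity)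
    gcongr
  · have h1 : max |n| |m| ≤ 8 * |(|n| - |m|)| ∧ max |n| |m| ≤ 8 * |(|n| - |l|)| := by
      generalize |n| = N at *
      generalize |m| = μ at *
      generalize |l| = ν at *
      rw [max_le_iff, max_le_iff]
      rcases abs_cases (N - μ) with h1 | h1 <;> rcases abs_cases (N - ν) with h2 | h2 <;>
      rcases abs_cases (μ - ν) with h3 | h3 <;> omega
    refine (_root_.norm_sub_le _ _).trans ?_
    have h2 := ha.norm_le_of_max_le hC hMpos h1.1
    have h3 := ha.norm_le_of_max_le hC hMpos h1.2
    have h4 : 0 ≤ C * h * (((|n| - |m| : ℤ) : ℝ) ^ 2)⁻¹ := by positivity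
    linarith

/-- The part of the bound in `norm_sub_le` that is summable in `n`. -/
def majorant (C : ℝ) (h : ℕ) (n m : ℤ) : ℝ :=
  C * h * (if 4 * (h : ℤ) < |(|n| - |m|)| then (((|n| - |m| : ℤ) : ℝ) ^ 2)⁻¹ else 0) +
    16 * C * (if |n| < |m| then |(m : ℝ)|⁻¹ else 0)

theorem majorant_nonneg (hC : 0 ≤ C) (h : ℕ) (n m : ℤ) : 0 ≤ majorant C h n m := by
  unfold majorant
  positivity

theorem norm_sub_le_majorant (ha : IsCZKernel a C) (hC : 0 ≤ C) {n m l : ℤ} {h : ℕ}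
    (hml : |m - l| ≤ h) (hm : 4 * (h : ℤ) < |(|n| - |m|)|) (hl : 4 * (h : ℤ) < |(|n| - |l|)|) :
    ‖a n m - a n l‖ ≤ majorant C h n m + 16 * C * (if |m| ≤ |n| then |(n : ℝ)|⁻¹ else 0) := by
  refine (ha.norm_sub_le hC hml hm hl).trans (le_of_eq ?_)
  rw [majorant, if_pos hm]
  rcases le_or_gt |m| |n| with h1 | h1
  · simp [h1, h1.not_gt]
  · simp [h1, h1.not_ge, h1.le]

theorem sum_majorant_le (hC : 0 ≤ C) {h : ℕ} (hh : h ≠ 0) (F : Finset ℤ) (m : ℤ) :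
    ∑ n ∈ F, majorant C h n m ≤ 33 * C := by
  have h1 := sum_inv_sq_abs_tail_le F |m| (H := 4 * h) (by positivity)
  have h2 : ∑ n ∈ F, (if |n| < |m| then |(m : ℝ)|⁻¹ else 0) ≤ 2 := by
    rw [← Finset.sum_filter, Finset.sum_const, nsmul_eq_mul]
    rcases eq_or_ne m 0 with rfl | hm
    · simp
    · have : (0 : ℝ) < |(m : ℝ)| := by positivity
      rw [← div_eq_mul_inv, div_le_iff₀ this]
      exact card_abs_lt F m
  have hh' : (0 : ℝ) < h := by positivity
  simp only [majorant, Finset.sum_add_distrib, ← Finset.mul_sum]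
  push_cast at h1 ⊢
  calc _ ≤ C * h * (4 * (4 * (h : ℝ))⁻¹) + 16 * C * 2 := by gcongr
    _ = 33 * C := by field_simp; ring

end IsCZKernel

namespace IsStopping

variable {φ : ℤ → ℝ} {t : ℝ} {E : Finset ℤ} {κ : ℤ → ℕ}

/-- The points close to `E` or to `-E`, at the scale given by `κ`. -/
def IsNear (E : Finset ℤ) (κ : ℤ → ℕ) (n : ℤ) : Prop :=
  ∃ m ∈ E, |(|n| - |m|)| ≤ 4 * 2 ^ κ m

open Classical in
theorem card_isNear_le (h : IsStopping φ t E κ) (F : Finset ℤ) :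
    ((F.filter (IsNear E κ)).card : ℝ) ≤ 22 * E.card := by
  have h1 : ∀ n ∈ F.filter (IsNear E κ), (1 : ℝ) ≤
      ∑ m ∈ E, if |(|n| - |m|)| ≤ ((5 * 2 ^ κ m : ℕ) : ℤ) then ((2 : ℝ) ^ κ m)⁻¹ else 0 := by
    intro n hn
    obtain ⟨m, hm, hnm⟩ := (Finset.mem_filter.1 hn).2
    have hsub : dyadicCube (κ m) m ⊆ E := fun l hl => (h.stable m hm l hl).1
    have h2 : ∀ l ∈ dyadicCube (κ m) m, ((2 : ℝ) ^ κ m)⁻¹ ≤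
        if |(|n| - |l|)| ≤ ((5 * 2 ^ κ l : ℕ) : ℤ) then ((2 : ℝ) ^ κ l)⁻¹ else 0 := by
      intro l hl
      rw [(h.stable m hm l hl).2, if_pos]
      have h3 := (abs_abs_sub_abs_le m l).trans (abs_sub_le_of_mem_dyadicCube hl)
      have h4 := abs_sub_le |n| |m| |l|
      push_cast
      linarith
    calc (1 : ℝ) = (dyadicCube (κ m) m).card • ((2 : ℝ) ^ κ m)⁻¹ := by
          rw [nsmul_eq_mul, card_dyadicCube, mul_inv_cancel₀ (by positivity)]
      _ ≤ _ := Finset.card_nsmul_le_sum _ _ _ h2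
      _ ≤ _ := Finset.sum_le_sum_of_subset_of_nonneg hsub fun _ _ _ => by positivity
  calc ((F.filter (IsNear E κ)).card : ℝ) = (F.filter (IsNear E κ)).card • (1 : ℝ) := by simp
    _ ≤ _ := Finset.card_nsmul_le_sum _ _ _ h1
    _ ≤ ∑ m ∈ E, (22 : ℝ) := by
        rw [Finset.sum_comm]
        refine Finset.sum_le_sum fun m _ => ?_
        have h3 : (0 : ℝ) < 2 ^ κ m := by positivity
        have h4 : (1 : ℝ) ≤ 2 ^ κ m := one_le_pow₀ one_le_two
        rw [← Finset.sum_filter, Finset.sum_const, nsmul_eq_mul, ← div_eq_mul_inv, div_le_iff₀ h3]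
        have h5 := card_abs_sub_le (F.filter (IsNear E κ)) |m| (5 * 2 ^ κ m)
        have h6 : (((F.filter (IsNear E κ)).filter
            fun n => |(|n| - |m|)| ≤ ((5 * 2 ^ κ m : ℕ) : ℤ)).card : ℝ) ≤
            4 * (5 * 2 ^ κ m) + 2 := by exact_mod_cast h5
        linarith
    _ = 22 * E.card := by rw [Finset.sum_const, nsmul_eq_mul, mul_comm]

theorem notMem_of_not_isNear {n : ℤ} (hn : ¬ IsNear E κ n) : n ∉ E ∧ -n ∉ E := by
  refine ⟨fun h => hn ⟨n, h, ?_⟩, fun h => hn ⟨-n, h, ?_⟩⟩ <;> simp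

variable {f : ℤ → ℂ} {a : ℤ → ℤ → ℂ} {C : ℝ}

theorem norm_sum_bad_le_majorant (h : IsStopping (fun n => ‖f n‖) t E κ) (ht : 0 ≤ t)
    (ha : IsCZKernel a C) (hC : 0 ≤ C) {n : ℤ} (hn : ¬ IsNear E κ n) :
    ‖∑ m ∈ E, a n m * (f m - goodPart E κ f m)‖ ≤
      ∑ m ∈ E, ‖f m‖ * IsCZKernel.majorant C (2 ^ κ m) n m + 64 * C * t := by
  have hfar : ∀ m ∈ E, 4 * ((2 ^ κ m : ℕ) : ℤ) < |(|n| - |m|)| := by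
    intro m hm
    by_contra! h1
    exact hn ⟨m, hm, by simpa using h1⟩
  refine (h.norm_sum_bad_le (a n) (fun m => IsCZKernel.majorant C (2 ^ κ m) n m +
    16 * C * (if |m| ≤ |n| then |(n : ℝ)|⁻¹ else 0)) fun m hm l hl => ?_).trans ?_
  · obtain ⟨h1, h2⟩ := h.stable m hm l hl
    refine ha.norm_sub_le_majorant hC ?_ (hfar m hm) (h2 ▸ hfar l h1)
    simpa using abs_sub_le_of_mem_dyadicCube hl
  · simp only [mul_add, Finset.sum_add_distrib]
    gcongr
    have h1 := h.hardy_le ht (notMem_of_not_isNear hn).1 (notMem_of_not_isNear hn).2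
    calc _ = 16 * C * ((∑ m ∈ E, if |m| ≤ |n| then ‖f m‖ else 0) / |(n : ℝ)|) := by
          rw [div_eq_mul_inv, Finset.sum_mul, Finset.mul_sum]
          refine Finset.sum_congr rfl fun m _ => ?_
          split_ifs <;> ring
      _ ≤ 16 * C * (4 * t) := by gcongr
      _ = _ := by ring

end IsStopping

/-- Chebyshev's inequality for finite sums. -/
theorem mul_card_filter_le {F : Finset ℤ} {u : ℤ → ℝ} (hu : ∀ n ∈ F, 0 ≤ u n) (t : ℝ) :
    t * (F.filter fun n => t < u n).card ≤ ∑ n ∈ F, u n := by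
  rw [mul_comm, ← nsmul_eq_mul]
  refine (Finset.card_nsmul_le_sum _ u t fun n hn => (Finset.mem_filter.1 hn).2.le).trans ?_
  exact Finset.sum_le_sum_of_subset_of_nonneg (Finset.filter_subset _ _) fun n hn _ => hu n hn

theorem weak_type_of_support {a : ℤ → ℤ → ℂ} {C B : ℝ} (ha : IsCZKernel a C) (hC : 0 ≤ C)
    (hB : 0 ≤ B) (h2 : IsLpBdd a 2 B) {s : Finset ℤ} (F : Finset ℤ) {f : ℤ → ℂ}
    (hf : ∀ n ∉ s, f n = 0) {t : ℝ} (ht : 0 < t) :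
    ((F.filter fun n => (64 * C + 2) * t < ‖∑ m ∈ s, a n m * f m‖).card : ℝ) ≤
      (44 + 8 * B + 66 * C) * (t⁻¹ * ∑ m ∈ s, if t / 2 < ‖f m‖ then ‖f m‖ else 0) +
      B * ((t ^ 2)⁻¹ * ∑ m ∈ s, if ‖f m‖ ≤ t then ‖f m‖ ^ 2 else 0) := by
  classical
  obtain ⟨E, κ, h⟩ := exists_isStopping (φ := fun n => ‖f n‖) (s := s) (fun _ => norm_nonneg _)
    (fun n hn => by simp [hf n hn]) ht
  set X := ∑ m ∈ s, if t / 2 < ‖f m‖ then ‖f m‖ else 0 with hX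
  set Y := ∑ m ∈ s, if ‖f m‖ ≤ t then ‖f m‖ ^ 2 else 0 with hY
  set g := goodPart E κ f with hg
  have hEX : ∑ m ∈ E, (if t / 2 < ‖f m‖ then ‖f m‖ else 0) ≤ X :=
    sum_le_sum_of_support (fun n => by positivity) fun n hn => by simp [hf n hn]
  have hcard : t * E.card ≤ 2 * X := (h.mul_card_le ht.le).trans (by gcongr)
  have hsum : ∑ m ∈ E, ‖f m‖ ≤ 2 * X := by
    calc _ ≤ ∑ m ∈ E, ((if t / 2 < ‖f m‖ then ‖f m‖ else 0) + t / 2) := by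
          refine Finset.sum_le_sum fun m _ => ?_
          split_ifs <;> linarith
      _ ≤ _ := by
          rw [Finset.sum_add_distrib, Finset.sum_const, nsmul_eq_mul]
          linarith
  have hgood : ∑ m ∈ s ∪ E, ‖g m‖ ^ 2 ≤ Y + 4 * t ^ 2 * E.card := by
    have h1 : ∀ m, ‖g m‖ ^ 2 ≤
        (if ‖f m‖ ≤ t then ‖f m‖ ^ 2 else 0) + if m ∈ E then 4 * t ^ 2 else 0 := by
      intro m
      by_cases hm : m ∈ E
      · rw [if_pos hm]
        refine le_add_of_nonneg_of_le (by positivity) ?_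
        calc _ ≤ (2 * t) ^ 2 := by gcongr; exact h.norm_goodPart_le hm
          _ = _ := by ring
      · rw [if_neg hm, add_zero, if_pos (h.le_of_notMem_self hm), hg, goodPart, if_neg hm]
    refine (Finset.sum_le_sum fun m _ => h1 m).trans ?_
    rw [Finset.sum_add_distrib]
    refine add_le_add (sum_le_sum_of_support (fun n => by positivity) fun n hn => ?_) ?_
    · simp [hf n hn]
    · rw [← Finset.sum_filter, Finset.sum_const, nsmul_eq_mul, mul_comm]
      gcongr
      exact fun m hm => (Finset.mem_filter.1 hm).2
  have hdecomp (n : ℤ) : ∑ m ∈ s, a n m * f m =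
      ∑ m ∈ s ∪ E, a n m * g m + ∑ m ∈ E, a n m * (f m - g m) := by
    rw [Finset.sum_subset (s₂ := s ∪ E) (f := fun m => a n m * f m) Finset.subset_union_left
      fun m _ hm => by simp [hf m hm]]
    rw [Finset.sum_subset (s₁ := E) (s₂ := s ∪ E) Finset.subset_union_right
      fun m _ hm => by simp [hg, goodPart, hm], ← Finset.sum_add_distrib]
    exact Finset.sum_congr rfl fun m _ => by ring
  let L (n : ℤ) : ℝ := ∑ m ∈ E, ‖f m‖ * IsCZKernel.majorant C (2 ^ κ m) n m
  have hL : t * (F.filter fun n => t < L n).card ≤ 66 * C * X := by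
    refine (mul_card_filter_le (fun n _ => Finset.sum_nonneg fun m _ =>
      mul_nonneg (norm_nonneg _) (IsCZKernel.majorant_nonneg hC _ _ _)) t).trans ?_
    rw [Finset.sum_comm]
    calc _ ≤ ∑ m ∈ E, ‖f m‖ * (33 * C) := by
          refine Finset.sum_le_sum fun m _ => ?_
          rw [← Finset.mul_sum]
          gcongr
          exact IsCZKernel.sum_majorant_le hC (by positivity) F m
      _ ≤ 2 * X * (33 * C) := by rw [← Finset.sum_mul]; gcongr
      _ = _ := by ring
  have hG : t ^ 2 * (F.filter fun n => t ^ 2 < ‖∑ m ∈ s ∪ E, a n m * g m‖ ^ 2).card ≤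
      B * (Y + 4 * t ^ 2 * E.card) := by
    refine (mul_card_filter_le (fun n _ => by positivity) _).trans ?_
    have := h2 (s ∪ E) F g
    simp only [Real.rpow_two] at this
    exact this.trans (by gcongr)
  have hsub : F.filter (fun n => (64 * C + 2) * t < ‖∑ m ∈ s, a n m * f m‖) ⊆
      F.filter (IsStopping.IsNear E κ) ∪
        (F.filter (fun n => t ^ 2 < ‖∑ m ∈ s ∪ E, a n m * g m‖ ^ 2) ∪
          F.filter fun n => t < L n) := by
    intro n hn
    simp only [Finset.mem_filter, Finset.mem_union] at hn ⊢
    by_contra! hcon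
    obtain ⟨h1, h3, h4⟩ := hcon
    have h5 := h.norm_sum_bad_le_majorant ht.le ha hC (h1 hn.1)
    have h6 := h4 hn.1
    have h7 : ‖∑ m ∈ s ∪ E, a n m * g m‖ ≤ t := le_of_sq_le_sq (h3 hn.1) ht.le
    have h8 := hn.2
    rw [hdecomp] at h8
    have h9 := norm_add_le (∑ m ∈ s ∪ E, a n m * g m) (∑ m ∈ E, a n m * (f m - g m))
    simp only [L] at h6
    linarith
  have hfinal : ((F.filter fun n => (64 * C + 2) * t < ‖∑ m ∈ s, a n m * f m‖).card : ℝ) ≤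
      (F.filter (IsStopping.IsNear E κ)).card +
        ((F.filter fun n => t ^ 2 < ‖∑ m ∈ s ∪ E, a n m * g m‖ ^ 2).card +
          (F.filter fun n => t < L n).card) := by
    exact_mod_cast (Finset.card_le_card hsub).trans ((Finset.card_union_le _ _).trans
      (Nat.add_le_add_left (Finset.card_union_le _ _) _))
  have hnear := h.card_isNear_le F
  have e1 : (E.card : ℝ) ≤ 2 * (t⁻¹ * X) := by
    rw [← mul_assoc, mul_comm 2, mul_assoc, ← div_eq_inv_mul, le_div_iff₀ ht]
    linarith
  have e2 : ((F.filter fun n => t < L n).card : ℝ) ≤ 66 * C * (t⁻¹ * X) := by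
    rw [← mul_assoc, mul_comm _ t⁻¹, mul_assoc, ← div_eq_inv_mul, le_div_iff₀ ht]
    linarith
  have e3 : ((F.filter fun n => t ^ 2 < ‖∑ m ∈ s ∪ E, a n m * g m‖ ^ 2).card : ℝ) ≤
      B * ((t ^ 2)⁻¹ * Y) + 4 * B * E.card := by
    have ht2 : 0 < t ^ 2 := by positivity
    rw [← mul_le_mul_iff_right₀ ht2]
    refine hG.trans (le_of_eq ?_)
    field_simp
  have e4 : 4 * B * E.card ≤ 4 * B * (2 * (t⁻¹ * X)) := by gcongr
  linarith

theorem weak_type {a : ℤ → ℤ → ℂ} {C B : ℝ} (ha : IsCZKernel a C) (hC : 0 ≤ C)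
    (hB : 0 ≤ B) (h2 : IsLpBdd a 2 B) (s F : Finset ℤ) (f : ℤ → ℂ) {t : ℝ} (ht : 0 < t) :
    ((F.filter fun n => (64 * C + 2) * t < ‖∑ m ∈ s, a n m * f m‖).card : ℝ) ≤
      (44 + 8 * B + 66 * C) * (t⁻¹ * ∑ m ∈ s, if t / 2 < ‖f m‖ then ‖f m‖ else 0) +
      B * ((t ^ 2)⁻¹ * ∑ m ∈ s, if ‖f m‖ ≤ t then ‖f m‖ ^ 2 else 0) := by
  classical
  have h := weak_type_of_support ha hC hB h2 (s := s) F
    (f := fun m => if m ∈ s then f m else 0) (fun n hn => if_neg hn) ht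
  have hcongr {M : Type} [AddCommMonoid M] (Φ : ℤ → ℂ → M) :
      ∑ m ∈ s, Φ m (if m ∈ s then f m else 0) = ∑ m ∈ s, Φ m (f m) :=
    Finset.sum_congr rfl fun m hm => by rw [if_pos hm]
  rw [hcongr fun _ z => if t / 2 < ‖z‖ then ‖z‖ else 0,
    hcongr fun _ z => if ‖z‖ ≤ t then ‖z‖ ^ 2 else 0] at h
  have hsum (n : ℤ) : ∑ m ∈ s, a n m * (if m ∈ s then f m else 0) = ∑ m ∈ s, a n m * f m :=
    hcongr fun m z => a n m * z
  simpa only [hsum] using h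

section LayerCake

open MeasureTheory Set

theorem integrableOn_rpow_lt {r : ℝ} (hr : -1 < r) {c : ℝ} (hc : 0 ≤ c) :
    IntegrableOn (fun t : ℝ => if t < c then t ^ r else 0) (Ioi 0) := by
  have h : (fun t : ℝ => if t < c then t ^ r else 0) = (Iio c).indicator fun t => t ^ r := rfl
  rw [h, IntegrableOn, integrable_indicator_iff measurableSet_Iio, IntegrableOn,
    Measure.restrict_restrict measurableSet_Iio, inter_comm, Ioi_inter_Iio]
  exact ((intervalIntegrable_iff_integrableOn_Ioo_of_le hc).1
    (intervalIntegral.intervalIntegrable_rpow' hr))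

theorem integral_rpow_lt {r : ℝ} (hr : -1 < r) {c : ℝ} (hc : 0 ≤ c) :
    ∫ t in Ioi (0 : ℝ), (if t < c then t ^ r else 0) = c ^ (r + 1) / (r + 1) := by
  have h : (fun t : ℝ => if t < c then t ^ r else 0) = (Iio c).indicator fun t => t ^ r := rfl
  rw [h, setIntegral_indicator measurableSet_Iio, Ioi_inter_Iio, ← integral_Ioc_eq_integral_Ioo,
    ← intervalIntegral.integral_of_le hc, integral_rpow (.inl hr),
    Real.zero_rpow (by linarith), sub_zero]

theorem integrableOn_rpow_ge {r : ℝ} (hr : r < -1) {c : ℝ} (hc : 0 < c) :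
    IntegrableOn (fun t : ℝ => if c ≤ t then t ^ r else 0) (Ioi 0) := by
  have h : (fun t : ℝ => if c ≤ t then t ^ r else 0) = (Ici c).indicator fun t => t ^ r := rfl
  rw [h, IntegrableOn, integrable_indicator_iff measurableSet_Ici, IntegrableOn,
    Measure.restrict_restrict measurableSet_Ici,
    inter_eq_left.2 (Ici_subset_Ioi.2 hc)]
  exact (integrableOn_Ici_iff_integrableOn_Ioi).2 (integrableOn_Ioi_rpow_of_lt hr hc)

theorem integral_rpow_ge {r : ℝ} (hr : r < -1) {c : ℝ} (hc : 0 < c) :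
    ∫ t in Ioi (0 : ℝ), (if c ≤ t then t ^ r else 0) = -c ^ (r + 1) / (r + 1) := by
  have h : (fun t : ℝ => if c ≤ t then t ^ r else 0) = (Ici c).indicator fun t => t ^ r := rfl
  rw [h, setIntegral_indicator measurableSet_Ici,
    inter_eq_right.2 (Ici_subset_Ioi.2 hc), integral_Ici_eq_integral_Ioi,
    integral_Ioi_rpow_of_lt hr hc]

/-- Marcinkiewicz-type interpolation: integration of a truncated weak-type bound. -/
theorem sum_rpow_le_of_weak_type {p A K₁ K₂ : ℝ} (hp1 : 1 < p) (hp2 : p < 2) (hA : 0 < A)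
    {s F : Finset ℤ} {u x : ℤ → ℝ} (hu : ∀ n, 0 ≤ u n) (hx : ∀ n, 0 ≤ x n)
    (h : ∀ t, 0 < t → ((F.filter fun n => A * t < u n).card : ℝ) ≤
      K₁ * (t⁻¹ * ∑ m ∈ s, if t / 2 < x m then x m else 0) +
      K₂ * ((t ^ 2)⁻¹ * ∑ m ∈ s, if x m ≤ t then x m ^ 2 else 0)) :
    ∑ n ∈ F, u n ^ p ≤
      A ^ p * p * (K₁ * (2 ^ (p - 1) / (p - 1)) + K₂ / (2 - p)) * ∑ m ∈ s, x m ^ p := by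
  let Φ (t : ℝ) : ℝ := ∑ n ∈ F, if t < u n / A then t ^ (p - 1) else 0
  let Ψ₁ (t : ℝ) : ℝ := ∑ m ∈ s, x m * if t < 2 * x m then t ^ (p - 2) else 0
  let Ψ₂ (t : ℝ) : ℝ := ∑ m ∈ s, x m ^ 2 * if x m ≤ t then t ^ (p - 3) else 0
  have hle : ∀ t ∈ Ioi (0 : ℝ), Φ t ≤ K₁ * Ψ₁ t + K₂ * Ψ₂ t := by
    intro t ht
    have ht : 0 < t := ht
    have e0 : Φ t = t ^ (p - 1) * (F.filter fun n => A * t < u n).card := by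
      simp only [Φ, lt_div_iff₀ hA, mul_comm t A]
      rw [← Finset.sum_filter, Finset.sum_const, nsmul_eq_mul, mul_comm]
    have e1 : Ψ₁ t = t ^ (p - 1) * (t⁻¹ * ∑ m ∈ s, if t / 2 < x m then x m else 0) := by
      rw [← mul_assoc, ← Real.rpow_neg_one, ← Real.rpow_add ht, Finset.mul_sum]
      refine Finset.sum_congr rfl fun m _ => ?_
      simp only [div_lt_iff₀ (two_pos : (0 : ℝ) < 2), mul_comm (x m) 2,
        show p - 1 + -1 = p - 2 by ring]
      split_ifs <;> ring
    have e2 : Ψ₂ t =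
        t ^ (p - 1) * ((t ^ 2)⁻¹ * ∑ m ∈ s, if x m ≤ t then x m ^ 2 else 0) := by
      rw [← mul_assoc, ← Real.rpow_two, ← Real.rpow_neg ht.le, ← Real.rpow_add ht,
        Finset.mul_sum]
      refine Finset.sum_congr rfl fun m _ => ?_
      rw [show p - 1 + -2 = p - 3 by ring]
      split_ifs <;> simp [mul_comm]
    have h1 := mul_le_mul_of_nonneg_left (h t ht) (Real.rpow_nonneg ht.le (p - 1))
    rw [e0, e1, e2]
    refine h1.trans (le_of_eq ?_)
    ring
  have hΦi : ∀ n ∈ F,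
      IntegrableOn (fun t : ℝ => if t < u n / A then t ^ (p - 1) else 0) (Ioi 0) :=
    fun n _ => integrableOn_rpow_lt (by linarith) (div_nonneg (hu n) hA.le)
  have hΨ₁i : ∀ m ∈ s,
      IntegrableOn (fun t : ℝ => x m * if t < 2 * x m then t ^ (p - 2) else 0) (Ioi 0) :=
    fun m _ => (integrableOn_rpow_lt (by linarith) (by linarith [hx m])).const_mul _
  have hΨ₂i : ∀ m ∈ s,
      IntegrableOn (fun t : ℝ => x m ^ 2 * if x m ≤ t then t ^ (p - 3) else 0) (Ioi 0) := by
    intro m _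
    rcases (hx m).eq_or_lt with h0 | h0
    · simp [← h0]
    · exact (integrableOn_rpow_ge (by linarith) h0).const_mul _
  have I0 : ∫ t in Ioi (0 : ℝ), Φ t = (A ^ p * p)⁻¹ * ∑ n ∈ F, u n ^ p := by
    rw [integral_finsetSum _ hΦi, Finset.mul_sum]
    refine Finset.sum_congr rfl fun n _ => ?_
    rw [integral_rpow_lt (by linarith) (div_nonneg (hu n) hA.le), sub_add_cancel,
      Real.div_rpow (hu n) hA.le]
    have : 0 < A ^ p := Real.rpow_pos_of_pos hA p
    field_simp
  have I1 : ∫ t in Ioi (0 : ℝ), Ψ₁ t = 2 ^ (p - 1) / (p - 1) * ∑ m ∈ s, x m ^ p := by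
    rw [integral_finsetSum _ hΨ₁i, Finset.mul_sum]
    refine Finset.sum_congr rfl fun m _ => ?_
    rw [integral_const_mul, integral_rpow_lt (by linarith) (by linarith [hx m]),
      show p - 2 + 1 = p - 1 by ring, Real.mul_rpow two_pos.le (hx m)]
    rcases (hx m).eq_or_lt with h0 | h0
    · rw [← h0, Real.zero_rpow (by linarith : p ≠ 0)]
      ring
    · rw [show x m ^ p = x m ^ (p - 1) * x m by
        rw [← Real.rpow_add_one h0.ne', sub_add_cancel]]
      ring
  have I2 : ∫ t in Ioi (0 : ℝ), Ψ₂ t = (2 - p)⁻¹ * ∑ m ∈ s, x m ^ p := by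
    rw [integral_finsetSum _ hΨ₂i, Finset.mul_sum]
    refine Finset.sum_congr rfl fun m _ => ?_
    rcases (hx m).eq_or_lt with h0 | h0
    · simp [← h0, Real.zero_rpow (by linarith : p ≠ 0)]
    · rw [integral_const_mul, integral_rpow_ge (by linarith) h0,
        show x m ^ p = x m ^ (p - 3 + 1) * x m ^ 2 by
          rw [← Real.rpow_two, ← Real.rpow_add h0]
          ring_nf,
        show p - 3 + 1 = -(2 - p) by ring, neg_div_neg_eq]
      ring
  have hΦI : IntegrableOn Φ (Ioi 0) := integrable_finsetSum _ hΦi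
  have hΨ₁I : IntegrableOn Ψ₁ (Ioi 0) := integrable_finsetSum _ hΨ₁i
  have hΨ₂I : IntegrableOn Ψ₂ (Ioi 0) := integrable_finsetSum _ hΨ₂i
  have hmain := setIntegral_mono_on hΦI ((hΨ₁I.const_mul K₁).add (hΨ₂I.const_mul K₂))
    measurableSet_Ioi hle
  simp only [Pi.add_apply] at hmain
  rw [integral_add (hΨ₁I.const_mul K₁) (hΨ₂I.const_mul K₂), integral_const_mul,
    integral_const_mul, I0, I1, I2, inv_mul_le_iff₀ (by positivity)] at hmain
  refine hmain.trans (le_of_eq ?_)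
  ring

end LayerCake

theorem IsCZKernel.isLpBdd_of_lt_two {a : ℤ → ℤ → ℂ} {C B : ℝ} (ha : IsCZKernel a C) (hC : 0 ≤ C)
    (hB : 0 ≤ B) (h2 : IsLpBdd a 2 B) {p : ℝ} (hp1 : 1 < p) (hp2 : p < 2) :
    ∃ B', 0 ≤ B' ∧ IsLpBdd a p B' := by
  refine ⟨(64 * C + 2) ^ p * p *
    ((44 + 8 * B + 66 * C) * (2 ^ (p - 1) / (p - 1)) + B / (2 - p)), ?_, fun s F f => ?_⟩
  · have h1 : 0 < p - 1 := by linarith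
    have h3 : 0 < 2 - p := by linarith
    positivity
  · exact sum_rpow_le_of_weak_type hp1 hp2 (by positivity) (fun _ => norm_nonneg _)
      (fun _ => norm_nonneg _) fun t ht => weak_type ha hC hB h2 s F f ht

/-- Duality: the transpose of a matrix bounded on `ℓ^p` is bounded on the dual space `ℓ^q`. -/
theorem IsLpBdd.transpose {a : ℤ → ℤ → ℂ} {p q B : ℝ} (hpq : p.HolderConjugate q) (hB : 0 ≤ B)
    (h : IsLpBdd a p B) : IsLpBdd (fun n m => a m n) q (B ^ (q / p)) := by
  intro s F f
  set u : ℤ → ℂ := fun n => ∑ m ∈ s, a m n * f m with hu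
  set v : ℤ → ℂ := fun n => starRingEnd ℂ (u n) * ((‖u n‖ ^ (q - 2) : ℝ) : ℂ) with hv
  set X := ∑ n ∈ F, ‖u n‖ ^ q with hX
  set Y := ∑ m ∈ s, ‖f m‖ ^ q with hY
  have hp := hpq.pos
  have hq := hpq.symm.pos
  have hX0 : 0 ≤ X := Finset.sum_nonneg fun _ _ => by positivity
  have hY0 : 0 ≤ Y := Finset.sum_nonneg fun _ _ => by positivity
  have huv (n : ℤ) : u n * v n = ((‖u n‖ ^ q : ℝ) : ℂ) := by
    rcases eq_or_ne (u n) 0 with h0 | h0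
    · simp [hv, h0, Real.zero_rpow hq.ne']
    · rw [hv, ← mul_assoc, Complex.mul_conj', ← Complex.ofReal_pow, ← Complex.ofReal_mul,
        ← Real.rpow_two, ← Real.rpow_add (norm_pos_iff.2 h0), add_sub_cancel]
  have hvp (n : ℤ) : ‖v n‖ ^ p = ‖u n‖ ^ q := by
    rcases eq_or_ne (u n) 0 with h0 | h0
    · simp [hv, h0, Real.zero_rpow hq.ne', Real.zero_rpow hp.ne']
    · have hpos := norm_pos_iff.2 h0
      rw [hv, norm_mul, RCLike.norm_conj, Complex.norm_real, Real.norm_of_nonneg (by positivity)]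
      nth_rw 1 [← Real.rpow_one ‖u n‖]
      rw [← Real.rpow_add hpos, ← Real.rpow_mul hpos.le]
      congr 1
      have := hpq.mul_eq_add
      linear_combination this
  have hpair : X ≤ ∑ m ∈ s, ‖f m‖ * ‖∑ n ∈ F, a m n * v n‖ := by
    have h1 : (X : ℂ) = ∑ m ∈ s, f m * ∑ n ∈ F, a m n * v n := by
      rw [hX, Complex.ofReal_sum]
      simp only [← huv]
      simp only [hu, Finset.sum_mul, Finset.mul_sum]
      rw [Finset.sum_comm]
      exact Finset.sum_congr rfl fun m _ => Finset.sum_congr rfl fun n _ => by ring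
    calc X = ‖(X : ℂ)‖ := by rw [Complex.norm_real, Real.norm_of_nonneg hX0]
      _ ≤ _ := by
        rw [h1]
        refine (norm_sum_le _ _).trans (le_of_eq ?_)
        simp only [norm_mul]
  have hholder := hpair.trans (Real.inner_le_Lp_mul_Lq s _ _ hpq.symm)
  simp only [abs_norm] at hholder
  have hbd := h F s v
  simp only [hvp] at hbd
  have hXY : X ≤ Y ^ (1 / q) * (B ^ (1 / p) * X ^ (1 / p)) := by
    refine hholder.trans ?_
    rw [← Real.mul_rpow hB hX0]
    gcongr
  rcases hX0.eq_or_lt with h0 | h0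
  · rw [← h0]
    positivity
  · have hsplit : X = X ^ (1 / q) * X ^ (1 / p) := by
      rw [← Real.rpow_add h0, one_div, one_div, hpq.symm.inv_add_inv_eq_one, Real.rpow_one]
    have hpos : 0 < X ^ (1 / p) := Real.rpow_pos_of_pos h0 _
    have h3 : X ^ (1 / q) ≤ Y ^ (1 / q) * B ^ (1 / p) := by
      rw [← mul_le_mul_iff_left₀ hpos, ← hsplit]
      linarith
    have h4 := Real.rpow_le_rpow (by positivity) h3 hq.le
    rw [Real.mul_rpow (by positivity) (by positivity), ← Real.rpow_mul hX0, ← Real.rpow_mul hY0,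
      ← Real.rpow_mul hB, one_div_mul_cancel hq.ne', Real.rpow_one, Real.rpow_one] at h4
    rw [show q / p = 1 / p * q by ring]
    linarith

/-- A matrix with the Calderón–Zygmund conditions in both variables which is bounded on `ℓ^2` is
bounded on `ℓ^p` for `1 < p < ∞`. -/
theorem IsCZKernel.isLpBdd {a : ℤ → ℤ → ℂ} {C B : ℝ} (ha : IsCZKernel a C)
    (ha' : IsCZKernel (fun n m => a m n) C) (hC : 0 ≤ C) (hB : 0 ≤ B) (h2 : IsLpBdd a 2 B)
    {p : ℝ} (hp : 1 < p) : ∃ B', 0 ≤ B' ∧ IsLpBdd a p B' := by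
  rcases lt_trichotomy p 2 with h | rfl | h
  · exact ha.isLpBdd_of_lt_two hC hB h2 hp h
  · exact ⟨B, hB, h2⟩
  · have hpq := Real.HolderConjugate.conjExponent hp
    have hq2 : p.conjExponent < 2 := by
      rw [Real.conjExponent, div_lt_iff₀ (by linarith)]
      linarith
    have h2' := h2.transpose Real.HolderConjugate.two_two hB
    obtain ⟨B', hB', h'⟩ := ha'.isLpBdd_of_lt_two hC (by positivity) h2' hpq.symm.lt hq2
    exact ⟨_, by positivity, h'.transpose hpq.symm hB'⟩

theorem IsLpBdd.exists_clm {a : ℤ → ℤ → ℂ} {p : ℝ≥0∞} [Fact (1 ≤ p)] {B : ℝ}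
    (hp : 1 < p.toReal) (hB : 0 ≤ B) (h : IsLpBdd a p.toReal B) :
    ∃ S : lp (fun _ : ℤ => ℂ) p →L[ℂ] lp (fun _ : ℤ => ℂ) p,
      ∀ (f : lp (fun _ : ℤ => ℂ) p) (n : ℤ), HasSum (fun m => a n m * f m) (S f n) := by
  have hpq := Real.HolderConjugate.conjExponent hp
  have hrow (n : ℤ) : Summable fun m => ‖a n m‖ ^ p.toReal.conjExponent := by
    exact summable_of_sum_le (fun _ => by positivity) fun F => by
      simpa using h.transpose hpq hB {n} F 1
  have hsum (f : lp (fun _ : ℤ => ℂ) p) (n : ℤ) : Summable fun m => a n m * f m := by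
    refine Summable.of_norm ?_
    simp only [norm_mul]
    exact (Real.summable_and_inner_le_Lp_mul_Lq_tsum_of_nonneg hpq.symm (fun _ => norm_nonneg _)
      (fun _ => norm_nonneg _) (hrow n) ((lp.memℓp f).summable hpq.pos)).1
  have hbd (f : lp (fun _ : ℤ => ℂ) p) (F : Finset ℤ) :
      ∑ n ∈ F, ‖∑' m, a n m * f m‖ ^ p.toReal ≤ B * ‖f‖ ^ p.toReal := by
    refine le_of_tendsto (tendsto_finsetSum F fun n _ =>
      ((hsum f n).hasSum.norm.rpow_const (.inr hpq.pos.le))) (.of_forall fun s => ?_)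
    exact (h s F f).trans (by gcongr; exact lp.sum_rpow_le_norm_rpow hpq.pos f s)
  let L : lp (fun _ : ℤ => ℂ) p →ₗ[ℂ] lp (fun _ : ℤ => ℂ) p :=
    { toFun := fun f => ⟨fun n => ∑' m, a n m * f m, memℓp_gen' (hbd f)⟩
      map_add' := fun f g => by
        ext n
        simp only [lp.coeFn_add, Pi.add_apply, mul_add]
        exact (hsum f n).tsum_add (hsum g n)
      map_smul' := fun c f => by
        ext n
        simp [mul_left_comm _ c, tsum_mul_left] }
  refine ⟨L.mkContinuous (B ^ (1 / p.toReal)) fun f => ?_, fun f n => (hsum f n).hasSum⟩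
  refine lp.norm_le_of_forall_sum_le hpq.pos (by positivity) fun F => ?_
  rw [Real.mul_rpow (by positivity) (norm_nonneg _), ← Real.rpow_mul hB,
    one_div_mul_cancel hpq.ne_zero, Real.rpow_one]
  exact hbd f F

section Matrix

variable (T : lp (fun _ : ℤ => ℂ) 2 →L[ℂ] lp (fun _ : ℤ => ℂ) 2)

/-- The matrix of a bounded operator on `ℓ^2`. -/
def matrixEntry (n m : ℤ) : ℂ := T (lp.single 2 m 1) n

theorem apply_single (n m : ℤ) (z : ℂ) :
    T (lp.single 2 m z) n = matrixEntry T n m * z := by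
  have : lp.single (E := fun _ : ℤ => ℂ) 2 m z = z • lp.single 2 m 1 := by
    rw [← lp.single_smul, smul_eq_mul, mul_one]
  rw [this, map_smul, matrixEntry, lp.coeFn_smul, Pi.smul_apply, smul_eq_mul, mul_comm]

theorem hasSum_matrixEntry (f : lp (fun _ : ℤ => ℂ) 2) (n : ℤ) :
    HasSum (fun m => matrixEntry T n m * f m) (T f n) := by
  have h := (lp.hasSum_single (by norm_num) f).mapL ((lp.evalCLM ℂ (fun _ : ℤ => ℂ) 2 n).comp T)
  exact h.congr_fun fun m => (apply_single T n m (f m)).symm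

theorem isLpBdd_matrixEntry : IsLpBdd (matrixEntry T) 2 (‖T‖ ^ 2) := by
  intro s F f
  set g : lp (fun _ : ℤ => ℂ) 2 := ∑ m ∈ s, lp.single 2 m (f m)
  have hg (n : ℤ) : T g n = ∑ m ∈ s, matrixEntry T n m * f m := by
    simp only [g, map_sum, lp.coeFn_sum, Finset.sum_apply, apply_single]
  have h1 := lp.sum_rpow_le_norm_rpow (by norm_num) (T g) F
  have h2 : ‖g‖ ^ (2 : ℝ) = ∑ m ∈ s, ‖f m‖ ^ (2 : ℝ) := by
    simpa using lp.norm_sum_single (p := 2) (by norm_num) f s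
  simp only [hg, ENNReal.toReal_ofNat] at h1
  refine h1.trans ?_
  rw [← h2, Real.rpow_two, Real.rpow_two, ← mul_pow]
  gcongr
  exact T.le_opNorm g

end Matrix

end DiscreteCZ

open DiscreteCZ

/-- a Calderón–Zygmund type `ℓ^p` theorem on `ℤ`.  If a bounded
operator `T` on `ℓ²(ℤ)` has a kernel `K` (off `|n| = |m|`) satisfying
(i) `|K(n,m)| ≤ C/|n-m|` and (ii) the Hörmander gradient condition
`|K(n,m)-K(n,ℓ)| + |K(m,n)-K(ℓ,n)| ≤ C|m-ℓ|/(|m|-|n|)²` whenever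
`||m|-|n|| > 2|m-ℓ|` and `|n|/2 ≤ |m|,|ℓ| ≤ 3|n|/2`, then `T` extends to a
bounded operator on `ℓ^p(ℤ)` for every `1 < p < ∞`. -/
theorem discrete_CZ_lp_bounded (C : ℝ) (hC : 0 < C) (K : ℤ → ℤ → ℂ)
    (hK1 : ∀ n m : ℤ, |n| ≠ |m| → ‖K n m‖ ≤ C / ((|n - m| : ℤ) : ℝ))
    (hK2 : ∀ n m ℓ : ℤ, |n| ≠ |m| → |n| ≠ |ℓ| →
      2 * |m - ℓ| < |(|m| - |n|)| →
      |n| ≤ 2 * |m| → 2 * |m| ≤ 3 * |n| → |n| ≤ 2 * |ℓ| → 2 * |ℓ| ≤ 3 * |n| →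
      ‖K n m - K n ℓ‖ + ‖K m n - K ℓ n‖
        ≤ C * ((|m - ℓ| : ℤ) : ℝ) / (((|m| - |n| : ℤ) : ℝ)) ^ 2)
    (T : lp (fun _ : ℤ => ℂ) 2 →L[ℂ] lp (fun _ : ℤ => ℂ) 2)
    (hT : ∀ f : lp (fun _ : ℤ => ℂ) 2,
      (Function.support (f : ∀ _ : ℤ, ℂ)).Finite →
      ∀ n : ℤ, (f : ∀ _ : ℤ, ℂ) n = 0 → (f : ∀ _ : ℤ, ℂ) (-n) = 0 →
        (T f : ∀ _ : ℤ, ℂ) n = ∑' m : ℤ, K n m * (f : ∀ _ : ℤ, ℂ) m)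
    (p : ℝ≥0∞) [Fact (1 ≤ p)] (hp1 : 1 < p) (hp2 : p < ⊤) :
    ∃ S : lp (fun _ : ℤ => ℂ) p →L[ℂ] lp (fun _ : ℤ => ℂ) p,
        ∀ (f2 : lp (fun _ : ℤ => ℂ) 2) (fp : lp (fun _ : ℤ => ℂ) p),
          (∀ n : ℤ, (fp : ∀ _ : ℤ, ℂ) n = (f2 : ∀ _ : ℤ, ℂ) n) →
          ∀ n : ℤ, (S fp : ∀ _ : ℤ, ℂ) n = (T f2 : ∀ _ : ℤ, ℂ) n := by
  classical
  have hp : 1 < p.toReal := by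
    rw [← ENNReal.toReal_one]
    exact (ENNReal.toReal_lt_toReal ENNReal.one_ne_top hp2.ne).2 hp1
  have hK (n m : ℤ) (hnm : |n| ≠ |m|) : matrixEntry T n m = K n m := by
    have h1 : n ≠ m := fun h => hnm (by rw [h])
    have h2 : -n ≠ m := fun h => hnm (by rw [← h, abs_neg])
    have h3 := hT (lp.single 2 m 1)
      ((Set.finite_singleton m).subset (by simp [lp.coeFn_single])) n
      (by simp [h1]) (by simp [h2])
    rw [matrixEntry, h3, tsum_eq_single m fun l hl => by simp [hl]]
    simp
  have ha : IsCZKernel (matrixEntry T) C :=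
    { size := fun n m h => by
        rw [hK n m h]
        exact hK1 n m h
      smooth := fun n m l h h' h1 h2 h3 h4 h5 => by
        rw [hK n m h, hK n l h']
        exact (le_add_of_nonneg_right (norm_nonneg _)).trans (hK2 n m l h h' h1 h2 h3 h4 h5) }
  have ha' : IsCZKernel (fun n m => matrixEntry T m n) C :=
    { size := fun n m h => by
        rw [hK m n h.symm, abs_sub_comm]
        exact hK1 m n h.symm
      smooth := fun n m l h h' h1 h2 h3 h4 h5 => by
        rw [hK m n h.symm, hK l n h'.symm]
        exact (le_add_of_nonneg_left (norm_nonneg _)).trans (hK2 n m l h h' h1 h2 h3 h4 h5) }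
  obtain ⟨B, hB, h⟩ := ha.isLpBdd ha' hC.le (by positivity) (isLpBdd_matrixEntry T) hp
  obtain ⟨S, hS⟩ := h.exists_clm hp hB
  refine ⟨S, fun f2 fp hf n => (hS fp n).unique ?_⟩
  simpa only [hf] using hasSum_matrixEntry T f2 n
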